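/- arXiv:1804.01710 — 3 statements merged into one kernel-verified Lean document; each statement's English description precedes it below -/
import Mathlib

section
/- The structure 𝔏 has quantifier elimination: for every first-order formula φ(x₁,…,xₙ) in the signature τ₀, there exists a quantifier-free τ₀-formula ψ(x₁,…,xₙ) such that for all a₁,…,aₙ ∈ ℚ, 𝔏 ⊨ φ(a₁,…,aₙ) if and only if 𝔏 ⊨ ψ(a₁,…,aₙ). -/
open FirstOrder Language

/-- The signature τ₀ = {<, 1} ∪ {c· : c ∈ ℚ}: one constant symbol (for 1),
a unary function symbol for each rational c (for multiplication by c),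
and one binary relation symbol (for <). -/
def tau0 : FirstOrder.Language :=
  ⟨fun n => match n with
    | 0 => Unit
    | 1 => ℚ
    | _ => Empty,
   fun n => match n with
    | 2 => Unit
    | _ => Empty⟩

/-- The structure 𝔏 = (ℚ; <, 1, (c·)_{c ∈ ℚ}). -/
instance LStruct : tau0.Structure ℚ where
  funMap {n} f x :=
    match n, f with
    | 0, _ => (1 : ℚ)
    | 1, (c : ℚ) => c * x 0
    | (_ + 2), f => f.elim
  RelMap {n} r x :=
    match n, r with
    | 2, _ => x 0 < x 1

open Filter Topology

namespace Tau0

/-- A predicate on valuations is quantifier-free definable if a quantifier-free formula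
defines it. -/
def QFDefinable {γ : Type} (P : (γ → ℚ) → Prop) : Prop :=
  ∃ ψ : tau0.Formula γ, ψ.IsQF ∧ ∀ w, ψ.Realize w ↔ P w

/-- A function of valuations is a term function if a term realizes it. -/
def IsTermFun {γ : Type} (f : (γ → ℚ) → ℚ) : Prop :=
  ∃ t : tau0.Term γ, ∀ w, t.realize w = f w

/-- The Boolean closure of the conditions on `(w, y)` which are quantifier-free in `w` or which
compare `y` with a term in `w`. -/
inductive Comparison {γ : Type} : ((γ → ℚ) → ℚ → Prop) → Prop
  | const {Q : (γ → ℚ) → Prop} (h : QFDefinable Q) : Comparison fun w _ => Q w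
  | lt {f : (γ → ℚ) → ℚ} (h : IsTermFun f) : Comparison fun w y => y < f w
  | gt {f : (γ → ℚ) → ℚ} (h : IsTermFun f) : Comparison fun w y => f w < y
  | imp {P Q : (γ → ℚ) → ℚ → Prop} (hP : Comparison P) (hQ : Comparison Q) :
      Comparison fun w y => P w y → Q w y

/-- A family of proper filters deciding every comparison with a term, in a quantifier-free
definable way. -/
structure DecidesTerms {γ : Type} (F : (γ → ℚ) → Filter ℚ) : Prop where
  neBot : ∀ w, (F w).NeBot
  lt : ∀ f, IsTermFun f → QFDefinable fun w => ∀ᶠ y in F w, y < f w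
  gt : ∀ f, IsTermFun f → QFDefinable fun w => ∀ᶠ y in F w, f w < y
  lt_or : ∀ f, IsTermFun f → ∀ w, (∀ᶠ y in F w, y < f w) ∨ ∀ᶠ y in F w, ¬ y < f w
  gt_or : ∀ f, IsTermFun f → ∀ w, (∀ᶠ y in F w, f w < y) ∨ ∀ᶠ y in F w, ¬ f w < y

variable {γ δ : Type}

theorem realize_smul (c : ℚ) (ts : Fin 1 → tau0.Term γ) (w : γ → ℚ) :
    Term.realize w (Term.func (L := tau0) (l := 1) c ts) = c * (ts 0).realize w := rfl

theorem IsTermFun.smul {f : (γ → ℚ) → ℚ} (hf : IsTermFun f) (c : ℚ) :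
    IsTermFun fun w => c * f w := by
  obtain ⟨t, ht⟩ := hf
  exact ⟨Term.func (L := tau0) (l := 1) c fun _ => t, fun w => by rw [realize_smul, ht]⟩

theorem isTermFun_one : IsTermFun fun _ : γ → ℚ => (1 : ℚ) :=
  ⟨Term.func (L := tau0) (l := 0) () Fin.elim0, fun _ => rfl⟩

theorem isTermFun_zero : IsTermFun fun _ : γ → ℚ => (0 : ℚ) := by
  simpa using (isTermFun_one (γ := γ)).smul 0

theorem isTermFun_apply (i : γ) : IsTermFun fun w : γ → ℚ => w i :=
  ⟨Term.var i, fun _ => rfl⟩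

namespace QFDefinable

theorem congr {P Q : (γ → ℚ) → Prop} (h : QFDefinable P) (e : ∀ w, P w ↔ Q w) :
    QFDefinable Q := by
  obtain ⟨ψ, hψ, H⟩ := h
  exact ⟨ψ, hψ, fun w => (H w).trans (e w)⟩

theorem false : QFDefinable fun _ : γ → ℚ => False :=
  ⟨⊥, BoundedFormula.isQF_bot, fun _ => Iff.rfl⟩

theorem imp {P Q : (γ → ℚ) → Prop} (hP : QFDefinable P) (hQ : QFDefinable Q) :
    QFDefinable fun w => P w → Q w := by
  obtain ⟨ψ, hψ, H⟩ := hP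
  obtain ⟨χ, hχ, K⟩ := hQ
  refine ⟨ψ.imp χ, hψ.imp hχ, fun w => ?_⟩
  rw [Formula.realize_imp, H, K]

theorem not {P : (γ → ℚ) → Prop} (hP : QFDefinable P) : QFDefinable fun w => ¬ P w :=
  hP.imp false

theorem true : QFDefinable fun _ : γ → ℚ => True :=
  false.not.congr fun _ => by simp

theorem or {P Q : (γ → ℚ) → Prop} (hP : QFDefinable P) (hQ : QFDefinable Q) :
    QFDefinable fun w => P w ∨ Q w :=
  (hP.not.imp hQ).congr fun _ => by tauto

theorem and {P Q : (γ → ℚ) → Prop} (hP : QFDefinable P) (hQ : QFDefinable Q) :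
    QFDefinable fun w => P w ∧ Q w :=
  (hP.imp hQ.not).not.congr fun _ => by tauto

theorem exists_mem {ι : Type*} (l : List ι) {P : ι → (γ → ℚ) → Prop}
    (h : ∀ i ∈ l, QFDefinable (P i)) : QFDefinable fun w => ∃ i ∈ l, P i w := by
  induction l with
  | nil => exact false.congr fun _ => by simp
  | cons a l ih =>
    refine ((h a (by simp)).or (ih fun i hi => h i (by simp [hi]))).congr fun _ => ?_
    simp

theorem lt {f g : (γ → ℚ) → ℚ} (hf : IsTermFun f) (hg : IsTermFun g) :
    QFDefinable fun w => f w < g w := by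
  obtain ⟨s, hs⟩ := hf
  obtain ⟨t, ht⟩ := hg
  let R : tau0.Relations 2 := ()
  refine ⟨R.formula₂ s t, (BoundedFormula.IsAtomic.rel _ _).isQF, fun w => ?_⟩
  rw [Formula.realize_rel₂]
  change s.realize w < t.realize w ↔ _
  rw [hs, ht]

theorem comp {P : (γ → ℚ) → Prop} (h : QFDefinable P) (g : γ → δ) :
    QFDefinable fun w : δ → ℚ => P (w ∘ g) := by
  obtain ⟨ψ, hψ, H⟩ := h
  refine ⟨ψ.relabel g, BoundedFormula.IsQF.relabel hψ _, fun w => ?_⟩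
  rw [Formula.realize_relabel, H]

end QFDefinable

namespace Comparison

theorem congr {P Q : (γ → ℚ) → ℚ → Prop} (h : Comparison P) (e : ∀ w y, P w y ↔ Q w y) :
    Comparison Q := by
  have : P = Q := by
    ext w y
    exact e w y
  exact this ▸ h

theorem false : Comparison fun (_ : γ → ℚ) _ => False := const .false

theorem not {P : (γ → ℚ) → ℚ → Prop} (h : Comparison P) : Comparison fun w y => ¬ P w y :=
  h.imp false

theorem and {P Q : (γ → ℚ) → ℚ → Prop} (hP : Comparison P) (hQ : Comparison Q) :
    Comparison fun w y => P w y ∧ Q w y :=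
  (hP.imp hQ.not).not.congr fun _ _ => by tauto

theorem smul_lt {f : (γ → ℚ) → ℚ} (hf : IsTermFun f) (c : ℚ) :
    Comparison fun w y => c * y < f w := by
  rcases lt_trichotomy c 0 with hc | rfl | hc
  · refine (gt (hf.smul c⁻¹)).congr fun w y => ?_
    rw [mul_comm, ← div_eq_mul_inv, div_lt_iff_of_neg' hc]
  · exact (const (.lt isTermFun_zero hf)).congr fun w y => by simp
  · refine (lt (hf.smul c⁻¹)).congr fun w y => ?_
    rw [lt_inv_mul_iff₀ hc]

theorem lt_smul {f : (γ → ℚ) → ℚ} (hf : IsTermFun f) (c : ℚ) :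
    Comparison fun w y => f w < c * y :=
  (smul_lt (hf.smul (-1)) (-c)).congr fun w y => by
    constructor <;> intro h <;> linarith

theorem exists_term_eq (t : tau0.Term (Option γ)) :
    (∃ c : ℚ, ∀ (w : γ → ℚ) y, t.realize (fun o => o.elim y w) = c * y) ∨
      ∃ f : (γ → ℚ) → ℚ, IsTermFun f ∧ ∀ w y, t.realize (fun o => o.elim y w) = f w := by
  induction t with
  | var o =>
    cases o with
    | none => exact .inl ⟨1, fun w y => by simp⟩
    | some i => exact .inr ⟨_, isTermFun_apply i, fun w y => rfl⟩
  | @func l g ts ih =>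
    match l, g with
    | 0, _ => exact .inr ⟨_, isTermFun_one, fun w y => rfl⟩
    | 1, (c : ℚ) =>
      rcases ih 0 with ⟨d, hd⟩ | ⟨f, hf, h⟩
      · refine .inl ⟨c * d, fun w y => ?_⟩
        rw [realize_smul, hd, mul_assoc]
      · refine .inr ⟨_, hf.smul c, fun w y => ?_⟩
        rw [realize_smul, h]
    | (_ + 2), g => exact g.elim

theorem term_lt (s t : tau0.Term (Option γ)) :
    Comparison fun w y =>
      s.realize (fun o => o.elim y w) < t.realize (fun o => o.elim y w) := by
  rcases exists_term_eq s with ⟨c, hc⟩ | ⟨f, hf, h⟩ <;>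
    rcases exists_term_eq t with ⟨d, hd⟩ | ⟨g, hg, k⟩
  · refine (smul_lt isTermFun_zero (c - d)).congr fun w y => ?_
    rw [hc, hd, sub_mul, sub_neg]
  · exact (smul_lt hg c).congr fun w y => by rw [hc, k]
  · exact (lt_smul hf d).congr fun w y => by rw [h, hd]
  · exact (const (.lt hf hg)).congr fun w y => by rw [h, k]

theorem term_eq (s t : tau0.Term (Option γ)) :
    Comparison fun w y =>
      s.realize (fun o => o.elim y w) = t.realize (fun o => o.elim y w) :=
  ((term_lt s t).not.and (term_lt t s).not).congr fun w y => by
    rw [not_lt, not_lt, and_comm, le_antisymm_iff]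

theorem of_isQF {ψ : tau0.Formula (Option γ)} (hψ : ψ.IsQF) :
    Comparison fun w y => ψ.Realize fun o => o.elim y w := by
  have key : ∀ {m : ℕ} {χ : tau0.BoundedFormula (Option γ) m}, χ.IsQF → ∀ hm : m = 0,
      Comparison fun w y => χ.Realize (fun o => o.elim y w) fun i => Fin.elim0 (hm ▸ i) := by
    intro m χ hχ hm
    subst hm
    have term_relabel (t : tau0.Term (Option γ ⊕ Fin 0)) (v : Option γ → ℚ) (xs : Fin 0 → ℚ) :
        t.realize (Sum.elim v xs) =
          (t.relabel (Sum.elim id Fin.elim0)).realize v := by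
      rw [Term.realize_relabel]
      congr 1
      ext (o | i)
      · rfl
      · exact i.elim0
    induction hχ with
    | falsum => exact false
    | imp _ _ h₁ h₂ => exact h₁.imp h₂
    | of_isAtomic h =>
      cases h with
      | equal s t =>
        refine (term_eq (s.relabel (Sum.elim id Fin.elim0))
          (t.relabel (Sum.elim id Fin.elim0))).congr fun w y => ?_
        rw [BoundedFormula.realize_bdEqual, term_relabel, term_relabel]
      | @rel l R ts =>
        match l, R with
        | 2, _ =>
          refine (term_lt ((ts 0).relabel (Sum.elim id Fin.elim0))
            ((ts 1).relabel (Sum.elim id Fin.elim0))).congr fun w y => ?_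
          rw [BoundedFormula.realize_rel, ← term_relabel _ _ Fin.elim0,
            ← term_relabel _ _ Fin.elim0]
          exact Iff.rfl
        | 0, R => exact R.elim
        | 1, R => exact R.elim
        | (_ + 3), R => exact R.elim
  refine (key hψ rfl).congr fun w y => ?_
  exact iff_of_eq (congrArg _ (Subsingleton.elim _ _))

theorem eventually_decided {P : (γ → ℚ) → ℚ → Prop} (hP : Comparison P)
    {F : (γ → ℚ) → Filter ℚ} (hF : DecidesTerms F) :
    (QFDefinable fun w => ∀ᶠ y in F w, P w y) ∧
      ∀ w, (∀ᶠ y in F w, P w y) ∨ ∀ᶠ y in F w, ¬ P w y := by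
  have := hF.neBot
  induction hP with
  | const h => exact ⟨h.congr fun w => by simp, fun w => by simpa using em _⟩
  | lt h => exact ⟨hF.lt _ h, hF.lt_or _ h⟩
  | gt h => exact ⟨hF.gt _ h, hF.gt_or _ h⟩
  | @imp P Q _ _ hP hQ =>
    refine ⟨(hP.1.imp hQ.1).congr fun w => ⟨fun h => ?_, fun h hp => hp.mp h⟩, fun w => ?_⟩
    · rcases hP.2 w with hp | hp
      · exact (h hp).mono fun y hy _ => hy
      · exact hp.mono fun y hy hy' => (hy hy').elim
    · rcases hP.2 w with hp | hp
      · rcases hQ.2 w with hq | hq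
        · exact .inl (hq.mono fun y hy _ => hy)
        · exact .inr ((hp.and hq).mono fun y hy h => hy.2 (h hy.1))
      · exact .inl (hp.mono fun y hy hy' => (hy hy').elim)

theorem exists_breakpoints {P : (γ → ℚ) → ℚ → Prop} (hP : Comparison P) :
    ∃ E : List ((γ → ℚ) → ℚ), (∀ f ∈ E, IsTermFun f) ∧
      ∀ w y z, (∀ f ∈ E, (y < f w ↔ z < f w) ∧ (f w < y ↔ f w < z)) → (P w y ↔ P w z) := by
  induction hP with
  | const h => exact ⟨[], by simp, by simp⟩
  | @lt f h => exact ⟨[f], by simpa using h, fun w y z H => (H f (by simp)).1⟩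
  | @gt f h => exact ⟨[f], by simpa using h, fun w y z H => (H f (by simp)).2⟩
  | imp _ _ hP hQ =>
    obtain ⟨E, hE, H⟩ := hP
    obtain ⟨E', hE', H'⟩ := hQ
    refine ⟨E ++ E', fun f hf => (List.mem_append.1 hf).elim (hE f) (hE' f), fun w y z h => ?_⟩
    exact imp_congr (H w y z fun f hf => h f (by simp [hf]))
      (H' w y z fun f hf => h f (by simp [hf]))

end Comparison

namespace DecidesTerms

theorem pure {e : (γ → ℚ) → ℚ} (he : IsTermFun e) : DecidesTerms fun w => (Pure.pure (e w)) where
  neBot _ := inferInstance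
  lt f hf := by simpa using QFDefinable.lt he hf
  gt f hf := by simpa using QFDefinable.lt hf he
  lt_or f _ w := by simpa using lt_or_ge (e w) (f w)
  gt_or f _ w := by simpa using lt_or_ge (f w) (e w)

theorem atBot : DecidesTerms fun _ : γ → ℚ => Filter.atBot where
  neBot _ := inferInstance
  lt f _ := QFDefinable.true.congr fun w => by simpa using eventually_lt_atBot (f w)
  gt f _ := QFDefinable.false.congr fun w => by
    rw [false_iff]
    intro h
    obtain ⟨y, hy, hy'⟩ := (h.and (eventually_lt_atBot (f w))).exists
    exact lt_asymm hy hy'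
  lt_or f _ w := .inl (eventually_lt_atBot (f w))
  gt_or f _ w := .inr ((eventually_lt_atBot (f w)).mono fun _ h => h.not_gt)

theorem nhdsGT {e : (γ → ℚ) → ℚ} (he : IsTermFun e) : DecidesTerms fun w => 𝓝[>] (e w) := by
  have lt_of {w : γ → ℚ} {f : (γ → ℚ) → ℚ} (h : e w < f w) : ∀ᶠ y in 𝓝[>] (e w), y < f w :=
    nhdsWithin_le_nhds (Iio_mem_nhds h)
  have gt_of {w : γ → ℚ} {f : (γ → ℚ) → ℚ} (h : f w ≤ e w) : ∀ᶠ y in 𝓝[>] (e w), f w < y :=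
    eventually_nhdsWithin_of_forall fun y hy => h.trans_lt hy
  refine ⟨fun w => inferInstance, fun f hf => ?_, fun f hf => ?_, fun f _ w => ?_, fun f _ w => ?_⟩
  · refine (QFDefinable.lt he hf).congr fun w => ⟨lt_of, fun h => ?_⟩
    by_contra! hle
    obtain ⟨y, hy, hy'⟩ := (h.and (gt_of hle)).exists
    exact lt_asymm hy hy'
  · refine (QFDefinable.lt he hf).not.congr fun w => ⟨fun h => gt_of (not_lt.1 h), fun h hlt => ?_⟩
    obtain ⟨y, hy, hy'⟩ := (h.and (lt_of hlt)).exists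
    exact lt_asymm hy hy'
  · rcases lt_or_ge (e w) (f w) with h | h
    · exact .inl (lt_of h)
    · exact .inr ((gt_of h).mono fun _ h => h.not_gt)
  · rcases lt_or_ge (e w) (f w) with h | h
    · exact .inr ((lt_of h).mono fun _ h => h.not_gt)
    · exact .inl (gt_of h)

end DecidesTerms

theorem Comparison.qfDefinable_exists {P : (γ → ℚ) → ℚ → Prop} (hP : Comparison P) :
    QFDefinable fun w => ∃ y, P w y := by
  obtain ⟨E, hE, H⟩ := hP.exists_breakpoints
  refine ((hP.eventually_decided .atBot).1.or (.exists_mem E fun e he =>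
    (hP.eventually_decided (.pure (hE e he))).1.or
      (hP.eventually_decided (.nhdsGT (hE e he))).1)).congr fun w => ⟨?_, ?_⟩
  · rintro (h | ⟨e, -, h | h⟩) <;> exact h.exists
  · rintro ⟨y, hy⟩
    by_cases hroot : ∃ e ∈ E, e w = y
    · obtain ⟨e, he, rfl⟩ := hroot
      exact .inr ⟨e, he, .inl (eventually_pure.2 hy)⟩
    push Not at hroot
    by_cases hbelow : ∃ e ∈ E, e w < y
    · obtain ⟨e, he, hmax⟩ := Set.exists_max_image {e | e ∈ E ∧ e w < y} (fun e => e w)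
        (E.finite_toSet.subset fun e he => he.1) hbelow
      refine .inr ⟨e, he.1, .inr ?_⟩
      filter_upwards [Ioo_mem_nhdsGT he.2] with z hz
      refine (H w y z fun f hf => ?_).1 hy
      rcases (hroot f hf).lt_or_gt with h | h
      · have hfz := (hmax f ⟨hf, h⟩).trans_lt hz.1
        simp [h, hfz, h.not_gt, hfz.not_gt]
      · have hfz := hz.2.trans h
        simp [h, hfz, h.not_gt, hfz.not_gt]
    · push Not at hbelow
      refine .inl ?_
      filter_upwards [eventually_lt_atBot y] with z hz
      refine (H w y z fun f hf => ?_).1 hy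
      have h := lt_of_le_of_ne (hbelow f hf) (hroot f hf).symm
      have hfz := hz.trans h
      simp [h, hfz, h.not_gt, hfz.not_gt]

theorem QFDefinable.exists {P : (Option γ → ℚ) → Prop} (h : QFDefinable P) :
    QFDefinable fun w : γ → ℚ => ∃ y : ℚ, P fun o => o.elim y w := by
  obtain ⟨ψ, hψ, H⟩ := h
  exact (Comparison.of_isQF hψ).qfDefinable_exists.congr fun w => by simp only [H]

theorem QFDefinable.forall {P : (Option γ → ℚ) → Prop} (h : QFDefinable P) :
    QFDefinable fun w : γ → ℚ => ∀ y : ℚ, P fun o => o.elim y w :=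
  h.not.exists.not.congr fun w => by simp

theorem qfDefinable_realize {α : Type} {k : ℕ} (φ : tau0.BoundedFormula α k) :
    QFDefinable fun w : α ⊕ Fin k → ℚ => φ.Realize (w ∘ Sum.inl) (w ∘ Sum.inr) := by
  induction φ with
  | falsum => exact .false
  | equal s t =>
    refine ⟨s.equal t, (BoundedFormula.IsAtomic.equal _ _).isQF, fun w => ?_⟩
    rw [Formula.realize_equal]
    simp [BoundedFormula.Realize]
  | rel R ts =>
    refine ⟨R.formula ts, (BoundedFormula.IsAtomic.rel _ _).isQF, fun w => ?_⟩
    rw [Formula.realize_rel]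
    simp [BoundedFormula.Realize]
  | imp _ _ h₁ h₂ => exact h₁.imp h₂
  | @all k φ ih =>
    let g : α ⊕ Fin (k + 1) → Option (α ⊕ Fin k) :=
      Sum.elim (fun a => some (.inl a)) (Fin.snoc (fun i => some (.inr i)) none)
    refine (ih.comp g).forall.congr fun w => ?_
    rw [BoundedFormula.realize_all]
    refine forall_congr' fun y => iff_of_eq ?_
    congr 1
    ext i
    refine Fin.lastCases ?_ (fun i => ?_) i <;> simp [g]

end Tau0

/-- The structure 𝔏 has quantifier elimination. -/
theorem L_quantifier_elimination (n : ℕ) (φ : tau0.Formula (Fin n)) :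
    ∃ ψ : tau0.Formula (Fin n), ψ.IsQF ∧
      ∀ v : Fin n → ℚ, φ.Realize v ↔ ψ.Realize v := by
  obtain ⟨ψ, hψ, H⟩ := (Tau0.qfDefinable_realize φ).comp (Sum.elim id Fin.elim0 : _ → Fin n)
  refine ⟨ψ, hψ, fun v => ?_⟩
  rw [H]
  unfold Formula.Realize
  refine iff_of_eq ?_
  congr 1
  exact Subsingleton.elim _ _
end

section
/- For every quantifier-free τ₀-formula φ(x, x₁,…,xₙ), there exists a quantifier-free τ₀-formula ψ(x₁,…,xₙ) such that for all a₁,…,aₙ ∈ ℚ, 𝔏 ⊨ (∃x. φ)(a₁,…,aₙ) if and only if 𝔏 ⊨ ψ(a₁,…,aₙ). -/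
open FirstOrder Language

open Filter Topology

/-- A predicate on `Fin n → ℚ` defined by a quantifier-free `tau0`-formula. -/
def QFDefinable {n : ℕ} (S : (Fin n → ℚ) → Prop) : Prop :=
  ∃ ψ : tau0.Formula (Fin n), ψ.IsQF ∧ ∀ v, ψ.Realize v ↔ S v

/-- A function on `Fin n → ℚ` given by a `tau0`-term. -/
def IsTermFun {n : ℕ} (f : (Fin n → ℚ) → ℚ) : Prop :=
  ∃ t : tau0.Term (Fin n), ∀ v, t.realize v = f v

lemma IsTermFun.const_mul {n : ℕ} {f : (Fin n → ℚ) → ℚ} (hf : IsTermFun f) (c : ℚ) :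
    IsTermFun fun v => c * f v := by
  obtain ⟨t, ht⟩ := hf
  refine ⟨Term.func (L := tau0) (l := 1) (show tau0.Functions 1 from c) fun _ => t, fun v => ?_⟩
  exact congrArg (c * ·) (ht v)

lemma IsTermFun.one {n : ℕ} : IsTermFun fun _ : Fin n → ℚ => 1 :=
  ⟨Term.func (L := tau0) (l := 0) (show tau0.Functions 0 from ()) Fin.elim0, fun _ => rfl⟩

lemma IsTermFun.zero {n : ℕ} : IsTermFun fun _ : Fin n → ℚ => 0 := by
  simpa using IsTermFun.one.const_mul (n := n) 0

namespace QFDefinable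

variable {n : ℕ} {S T : (Fin n → ℚ) → Prop}

lemma congr (hS : QFDefinable S) (h : ∀ v, S v ↔ T v) : QFDefinable T := by
  obtain ⟨ψ, hψ, hr⟩ := hS
  exact ⟨ψ, hψ, fun v => (hr v).trans (h v)⟩

lemma false : QFDefinable fun _ : Fin n → ℚ => False :=
  ⟨⊥, BoundedFormula.isQF_bot, fun _ => Iff.rfl⟩

lemma imp (hS : QFDefinable S) (hT : QFDefinable T) : QFDefinable fun v => S v → T v := by
  obtain ⟨ψ, hψ, hr⟩ := hS
  obtain ⟨χ, hχ, hs⟩ := hT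
  exact ⟨BoundedFormula.imp ψ χ, hψ.imp hχ, fun v => imp_congr (hr v) (hs v)⟩

lemma not (hS : QFDefinable S) : QFDefinable fun v => ¬ S v := hS.imp false

lemma or (hS : QFDefinable S) (hT : QFDefinable T) : QFDefinable fun v => S v ∨ T v :=
  (hS.not.imp hT).congr fun v => by tauto

lemma exists_mem_list {α : Type*} (l : List α) {S : α → (Fin n → ℚ) → Prop}
    (h : ∀ a ∈ l, QFDefinable (S a)) : QFDefinable fun v => ∃ a ∈ l, S a v := by
  induction l with
  | nil => exact false.congr (by simp)
  | cons a l ih =>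
    exact ((h a (by simp)).or (ih fun b hb => h b (by simp [hb]))).congr (by simp)

lemma lt {f g : (Fin n → ℚ) → ℚ} (hf : IsTermFun f) (hg : IsTermFun g) :
    QFDefinable fun v => f v < g v := by
  obtain ⟨s, hs⟩ := hf
  obtain ⟨t, ht⟩ := hg
  refine ⟨Relations.formula (L := tau0) (n := 2) (show tau0.Relations 2 from ()) ![s, t],
    (BoundedFormula.IsAtomic.rel _ _).isQF, fun v => ?_⟩
  refine Formula.realize_rel.trans ?_
  change s.realize v < t.realize v ↔ f v < g v
  rw [hs v, ht v]

end QFDefinable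

/-- A predicate is decided by a filter if it eventually holds or eventually fails. -/
def Filter.Decides {α : Type*} (l : Filter α) (p : α → Prop) : Prop :=
  (∀ᶠ x in l, p x) ∨ ∀ᶠ x in l, ¬ p x

namespace Filter.Decides

variable {α : Type*} {l : Filter α} {p q : α → Prop}

lemma imp (hp : l.Decides p) (hq : l.Decides q) : l.Decides fun x => p x → q x := by
  rcases hp with hp | hp
  · rcases hq with hq | hq
    · exact .inl (hq.mono fun x hx _ => hx)
    · exact .inr ((hp.and hq).mono fun x hx h => hx.2 (h hx.1))
  · exact .inl (hp.mono fun x hx h => (hx h).elim)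

lemma eventually_imp_iff [l.NeBot] (hp : l.Decides p) :
    (∀ᶠ x in l, p x → q x) ↔ ((∀ᶠ x in l, p x) → ∀ᶠ x in l, q x) := by
  refine ⟨fun h hp => hp.mp h, fun h => ?_⟩
  rcases hp with hp | hp
  · exact (h hp).mono fun x hx _ => hx
  · exact hp.mono fun x hx h => (hx h).elim

lemma const (P : Prop) : l.Decides fun _ : α => P := by
  by_cases h : P
  · exact .inl (Eventually.of_forall fun _ => h)
  · exact .inr (Eventually.of_forall fun _ => h)

end Filter.Decides

/-- Parametrized predicates on `ℚ` that are constant between finitely many term-definable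
endpoints, and whose values at, just above, and far below term-definable points are
quantifier-free definable. -/
structure Eliminable {n : ℕ} (P : (Fin n → ℚ) → ℚ → Prop) : Prop where
  endpoints : ∃ T : List ((Fin n → ℚ) → ℚ), (∀ f ∈ T, IsTermFun f) ∧
    ∀ v a b, (∀ f ∈ T, (a < f v ↔ b < f v) ∧ (f v < a ↔ f v < b)) → (P v a ↔ P v b)
  decides_nhdsGT : ∀ v a, (𝓝[>] a).Decides (P v)
  decides_atBot : ∀ v, atBot.Decides (P v)
  definable_apply : ∀ f, IsTermFun f → QFDefinable fun v => P v (f v)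
  definable_nhdsGT : ∀ f, IsTermFun f → QFDefinable fun v => ∀ᶠ x in 𝓝[>] (f v), P v x
  definable_atBot : QFDefinable fun v => ∀ᶠ x in atBot, P v x

namespace Eliminable

variable {n : ℕ} {P Q : (Fin n → ℚ) → ℚ → Prop}

lemma congr (hP : Eliminable P) (h : ∀ v x, P v x ↔ Q v x) : Eliminable Q := by
  have : P = Q := by
    funext v x
    exact propext (h v x)
  exact this ▸ hP

lemma of_definable {S : (Fin n → ℚ) → Prop} (hS : QFDefinable S) :
    Eliminable fun v _ => S v where
  endpoints := ⟨[], by simp, fun _ _ _ _ => Iff.rfl⟩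
  decides_nhdsGT _ _ := .const _
  decides_atBot _ := .const _
  definable_apply _ _ := hS
  definable_nhdsGT _ _ := hS.congr fun v => by simp
  definable_atBot := hS.congr fun v => eventually_const.symm

lemma imp (hP : Eliminable P) (hQ : Eliminable Q) : Eliminable fun v x => P v x → Q v x where
  endpoints := by
    obtain ⟨T, hT, hTP⟩ := hP.endpoints
    obtain ⟨U, hU, hUQ⟩ := hQ.endpoints
    refine ⟨T ++ U, fun f hf => (List.mem_append.1 hf).elim (hT f) (hU f), fun v a b h => ?_⟩
    exact imp_congr (hTP v a b fun f hf => h f (by simp [hf]))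
      (hUQ v a b fun f hf => h f (by simp [hf]))
  decides_nhdsGT v a := (hP.decides_nhdsGT v a).imp (hQ.decides_nhdsGT v a)
  decides_atBot v := (hP.decides_atBot v).imp (hQ.decides_atBot v)
  definable_apply f hf := (hP.definable_apply f hf).imp (hQ.definable_apply f hf)
  definable_nhdsGT f hf := ((hP.definable_nhdsGT f hf).imp (hQ.definable_nhdsGT f hf)).congr
    fun v => (hP.decides_nhdsGT v (f v)).eventually_imp_iff.symm
  definable_atBot := (hP.definable_atBot.imp hQ.definable_atBot).congr
    fun v => (hP.decides_atBot v).eventually_imp_iff.symm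

lemma not (hP : Eliminable P) : Eliminable fun v x => ¬ P v x :=
  hP.imp (of_definable .false)

lemma eventually_nhdsGT_lt_iff (a b : ℚ) : (∀ᶠ x in 𝓝[>] a, x < b) ↔ a < b := by
  refine ⟨fun h => ?_, fun h => mem_of_superset (Ioo_mem_nhdsGT h) fun x hx => hx.2⟩
  obtain ⟨x, hx, hax⟩ := (h.and self_mem_nhdsWithin).exists
  exact lt_trans hax hx

lemma eventually_nhdsGT_not_lt {a b : ℚ} (h : b ≤ a) : ∀ᶠ x in 𝓝[>] a, ¬ x < b :=
  mem_of_superset self_mem_nhdsWithin fun _ hx => not_lt.2 (h.trans (le_of_lt hx))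

lemma eventually_nhdsGT_gt_iff (a b : ℚ) : (∀ᶠ x in 𝓝[>] a, b < x) ↔ ¬ a < b := by
  refine ⟨fun h hab => ?_, fun h =>
    mem_of_superset self_mem_nhdsWithin fun x hx => lt_of_le_of_lt (not_lt.1 h) hx⟩
  obtain ⟨x, hx, hxb⟩ := (h.and ((eventually_nhdsGT_lt_iff a b).2 hab)).exists
  exact lt_asymm hx hxb

lemma var_lt {f : (Fin n → ℚ) → ℚ} (hf : IsTermFun f) : Eliminable fun v x => x < f v where
  endpoints := ⟨[f], by simpa using hf, fun v a b h => (h f (by simp)).1⟩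
  decides_nhdsGT v a := by
    rcases lt_or_ge a (f v) with h | h
    · exact .inl ((eventually_nhdsGT_lt_iff _ _).2 h)
    · exact .inr (eventually_nhdsGT_not_lt h)
  decides_atBot v := .inl (eventually_lt_atBot _)
  definable_apply g hg := .lt hg hf
  definable_nhdsGT g hg := (QFDefinable.lt hg hf).congr
    fun v => (eventually_nhdsGT_lt_iff _ _).symm
  definable_atBot := QFDefinable.false.not.congr fun v => by
    simpa using eventually_lt_atBot (f v)

lemma lt_var {f : (Fin n → ℚ) → ℚ} (hf : IsTermFun f) : Eliminable fun v x => f v < x where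
  endpoints := ⟨[f], by simpa using hf, fun v a b h => (h f (by simp)).2⟩
  decides_nhdsGT v a := by
    by_cases h : a < f v
    · exact .inr (((eventually_nhdsGT_lt_iff _ _).2 h).mono fun x hx => lt_asymm hx)
    · exact .inl ((eventually_nhdsGT_gt_iff _ _).2 h)
  decides_atBot v := .inr ((eventually_lt_atBot (f v)).mono fun x hx => lt_asymm hx)
  definable_apply g hg := .lt hf hg
  definable_nhdsGT g hg := (QFDefinable.lt hg hf).not.congr
    fun v => (eventually_nhdsGT_gt_iff _ _).symm
  definable_atBot := QFDefinable.false.congr fun v => by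
    refine ⟨False.elim, fun h => ?_⟩
    obtain ⟨x, hx, hx'⟩ := (h.and (eventually_lt_atBot (f v))).exists
    exact lt_asymm hx hx'

lemma mul_var_lt {f : (Fin n → ℚ) → ℚ} (c : ℚ) (hf : IsTermFun f) :
    Eliminable fun v x => c * x < f v := by
  rcases lt_trichotomy c 0 with hc | rfl | hc
  · refine (lt_var (hf.const_mul c⁻¹)).congr fun v x => ?_
    rw [inv_mul_eq_div, div_lt_iff_of_neg hc, mul_comm]
  · exact (of_definable (QFDefinable.lt .zero hf)).congr fun v x => by simp
  · refine (var_lt (hf.const_mul c⁻¹)).congr fun v x => ?_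
    rw [inv_mul_eq_div, lt_div_iff₀ hc, mul_comm]

lemma lt_mul_var {f : (Fin n → ℚ) → ℚ} (c : ℚ) (hf : IsTermFun f) :
    Eliminable fun v x => f v < c * x :=
  (mul_var_lt (-c) (hf.const_mul (-1))).congr fun v x => by
    rw [neg_mul, neg_one_mul, neg_lt_neg_iff]

lemma exists_definable (hP : Eliminable P) : QFDefinable fun v => ∃ x, P v x := by
  obtain ⟨T, hT, hTP⟩ := hP.endpoints
  refine (hP.definable_atBot.or ((QFDefinable.exists_mem_list T fun f hf =>
    (hP.definable_apply f (hT f hf)).or (hP.definable_nhdsGT f (hT f hf))))).congr fun v => ?_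
  constructor
  · rintro (h | ⟨f, -, h | h⟩)
    · exact h.exists
    · exact ⟨_, h⟩
    · exact h.exists
  · rintro ⟨a, ha⟩
    by_cases hmem : ∃ f ∈ T, f v = a
    · obtain ⟨f, hf, rfl⟩ := hmem
      exact .inr ⟨f, hf, .inl ha⟩
    push Not at hmem
    by_cases hlow : ∃ f ∈ T, f v < a
    · obtain ⟨g, hg, hga⟩ := hlow
      obtain ⟨f, hf, hmax⟩ := Set.exists_max_image {f | f ∈ T ∧ f v < a} (fun f => f v)
        ((List.finite_toSet T).subset fun f hf => hf.1) ⟨g, hg, hga⟩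
      refine .inr ⟨f, hf.1, .inr (mem_of_superset (Ioo_mem_nhdsGT hf.2) fun x hx => ?_)⟩
      refine (hTP v a x fun k hk => ?_).1 ha
      rcases lt_or_gt_of_ne (hmem k hk) with h | h
      · have := hmax k ⟨hk, h⟩
        have := hx.1
        constructor <;> constructor <;> intro <;> linarith
      · have := hx.2
        constructor <;> constructor <;> intro <;> linarith
    · push Not at hlow
      refine .inl ((eventually_lt_atBot a).mono fun x hx => (hTP v a x fun k hk => ?_).1 ha)
      have := lt_of_le_of_ne (hlow k hk) (hmem k hk).symm
      constructor <;> constructor <;> intro <;> linarith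

end Eliminable

lemma tau0_term_realize_cases {n : ℕ} (t : tau0.Term (Fin n ⊕ Fin 1)) :
    (∃ c : ℚ, ∀ (v : Fin n → ℚ) (x : Fin 1 → ℚ), t.realize (Sum.elim v x) = c * x 0) ∨
    ∃ f, IsTermFun f ∧
      ∀ (v : Fin n → ℚ) (x : Fin 1 → ℚ), t.realize (Sum.elim v x) = f v := by
  induction t with
  | var i =>
    rcases i with i | i
    · exact .inr ⟨fun v => v i, ⟨Term.var i, fun _ => rfl⟩, fun _ _ => rfl⟩
    · refine .inl ⟨1, fun v x => ?_⟩
      rw [one_mul, Subsingleton.elim 0 i]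
      rfl
  | @func l F ts ih =>
    match l, F with
    | 0, _ => exact .inr ⟨_, .one, fun _ _ => rfl⟩
    | 1, (c : ℚ) =>
      have key (v : Fin n → ℚ) (x : Fin 1 → ℚ) :
          (Term.func (L := tau0) (l := 1) (show tau0.Functions 1 from c) ts).realize
            (Sum.elim v x) = c * (ts 0).realize (Sum.elim v x) := rfl
      rcases ih 0 with ⟨d, hd⟩ | ⟨f, hf, hd⟩
      · exact .inl ⟨c * d, fun v x => (key v x).trans (by rw [hd, mul_assoc])⟩
      · exact .inr ⟨_, hf.const_mul c, fun v x => (key v x).trans (by rw [hd])⟩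
    | (_ + 2), F => exact F.elim

lemma Eliminable.term_lt {n : ℕ} (s t : tau0.Term (Fin n ⊕ Fin 1)) :
    Eliminable fun (v : Fin n → ℚ) (x : ℚ) =>
      s.realize (Sum.elim v fun _ => x) < t.realize (Sum.elim v fun _ => x) := by
  rcases tau0_term_realize_cases s with ⟨c, hs⟩ | ⟨f, hf, hs⟩ <;>
    rcases tau0_term_realize_cases t with ⟨d, ht⟩ | ⟨g, hg, ht⟩ <;> simp only [hs, ht]
  · refine (mul_var_lt (c - d) .zero).congr fun v x => ?_
    exact (sub_mul c d x).symm ▸ sub_neg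
  · exact mul_var_lt c hg
  · exact lt_mul_var d hf
  · exact of_definable (.lt hf hg)

lemma Eliminable.of_isQF {n : ℕ} {φ : tau0.BoundedFormula (Fin n) 1} (hφ : φ.IsQF) :
    Eliminable fun (v : Fin n → ℚ) (x : ℚ) => φ.Realize v fun _ => x := by
  induction hφ with
  | falsum => exact of_definable .false
  | of_isAtomic h =>
    cases h with
    | equal s t =>
      refine ((term_lt s t).not.imp (term_lt t s).not.not).not.congr fun v x => ?_
      rw [BoundedFormula.realize_bdEqual, le_antisymm_iff, ← not_lt, ← not_lt]
      tauto
    | @rel l R ts =>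
      match l, R with
      | 0, R => exact R.elim
      | 1, R => exact R.elim
      | 2, _ => exact term_lt (ts 0) (ts 1)
      | (_ + 3), R => exact R.elim
  | imp _ _ hP hQ => exact hP.imp hQ

/-- For every quantifier-free τ₀-formula φ(x, x₁,…,xₙ) (with one additional
variable x over which we existentially quantify), there is a quantifier-free
τ₀-formula ψ(x₁,…,xₙ) equivalent to ∃x. φ over 𝔏. -/
theorem L_exists_elimination (n : ℕ) (φ : tau0.BoundedFormula (Fin n) 1)
    (hφ : φ.IsQF) :
    ∃ ψ : tau0.Formula (Fin n), ψ.IsQF ∧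
      ∀ v : Fin n → ℚ, Formula.Realize (L := tau0) (M := ℚ) φ.ex v ↔ ψ.Realize v := by
  obtain ⟨ψ, hψ, h⟩ := (Eliminable.of_isQF hφ).exists_definable
  refine ⟨ψ, hψ, fun v => ?_⟩
  rw [h v, Formula.Realize, BoundedFormula.realize_ex]
  refine exists_congr fun x => ?_
  refine iff_of_eq (congrArg (φ.Realize v) (funext fun i => ?_))
  obtain rfl : i = Fin.last 0 := Subsingleton.elim (α := Fin 1) _ _
  exact Fin.snoc_last (n := 0) (α := fun _ => ℚ) x _
end

section
/- The cost function f : ℚ² → ℚ ∪ {+∞} defined by f(x,y) = 3x if 0 ≤ y < 2x, f(x,y) = (3/2)y if 0 ≤ 2x ≤ y, and f(x,y) = +∞ otherwise, is submodular. -/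
/-- A cost function f : ℚⁿ → ℚ ∪ {+∞} is submodular if
f(max(x,y)) + f(min(x,y)) ≤ f(x) + f(y) for all x, y ∈ ℚⁿ,
with max and min taken componentwise. -/
def Submodular {n : ℕ} (f : (Fin n → ℚ) → WithTop ℚ) : Prop :=
  ∀ x y : Fin n → ℚ,
    f (fun i => max (x i) (y i)) + f (fun i => min (x i) (y i)) ≤ f x + f y

/-- The example cost function is `max (3 * a) (3 / 2 * b)` on the nonnegative quadrant
and `⊤` elsewhere. -/
theorem exampleCost_eq_ite_max (a b : ℚ) :
    (if 0 ≤ b ∧ b < 2 * a then ((3 * a : ℚ) : WithTop ℚ)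
      else if 0 ≤ 2 * a ∧ 2 * a ≤ b then ((3 / 2 * b : ℚ) : WithTop ℚ)
      else ⊤) =
    if 0 ≤ a ∧ 0 ≤ b then ((max (3 * a) (3 / 2 * b) : ℚ) : WithTop ℚ) else ⊤ := by
  by_cases h : 0 ≤ a ∧ 0 ≤ b
  · obtain ⟨ha, hb⟩ := h
    rcases lt_or_ge b (2 * a) with hab | hab
    · rw [if_pos ⟨hb, hab⟩, if_pos ⟨ha, hb⟩, max_eq_left (by linarith)]
    · rw [if_neg (fun h => absurd h.2 hab.not_gt), if_pos ⟨by linarith, hab⟩, if_pos ⟨ha, hb⟩,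
        max_eq_right (by linarith)]
  · rw [if_neg h, if_neg, if_neg]
    · rintro ⟨h₁, h₂⟩
      exact h ⟨by linarith, by linarith⟩
    · rintro ⟨h₁, h₂⟩
      exact h ⟨by linarith, h₁⟩

/-- The maximum of two nonnegative multiples of the coordinates is submodular on `ℚ²`. -/
theorem max_mul_submodular {r s : ℚ} (hr : 0 ≤ r) (hs : 0 ≤ s) (a b c d : ℚ) :
    max (r * max a c) (s * max b d) + max (r * min a c) (s * min b d) ≤
      max (r * a) (s * b) + max (r * c) (s * d) := by
  rw [mul_max_of_nonneg _ _ hr, mul_max_of_nonneg _ _ hs, mul_min_of_nonneg _ _ hr,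
    mul_min_of_nonneg _ _ hs]
  grind

/-- The cost function f(x,y) = 3x if 0 ≤ y < 2x, f(x,y) = (3/2)y if
0 ≤ 2x ≤ y, and f(x,y) = +∞ otherwise, is submodular. -/
theorem example_cost_function_submodular :
    Submodular (fun p : Fin 2 → ℚ =>
      if 0 ≤ p 1 ∧ p 1 < 2 * p 0 then ((3 * p 0 : ℚ) : WithTop ℚ)
      else if 0 ≤ 2 * p 0 ∧ 2 * p 0 ≤ p 1 then ((3 / 2 * p 1 : ℚ) : WithTop ℚ)
      else ⊤) := by
  intro x y
  simp only [exampleCost_eq_ite_max]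
  by_cases hx : 0 ≤ x 0 ∧ 0 ≤ x 1
  · by_cases hy : 0 ≤ y 0 ∧ 0 ≤ y 1
    · rw [if_pos hx, if_pos hy, if_pos ⟨le_max_of_le_left hx.1, le_max_of_le_left hx.2⟩,
        if_pos ⟨le_min hx.1 hy.1, le_min hx.2 hy.2⟩, ← WithTop.coe_add, ← WithTop.coe_add,
        WithTop.coe_le_coe]
      exact max_mul_submodular (by norm_num) (by norm_num) _ _ _ _
    · rw [if_neg hy, WithTop.add_top]
      exact le_top
  · rw [if_neg hx, WithTop.top_add]
    exact le_top
end
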